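/- Let η(X) = ∑_{i=1}^r A_i X A_iᴴ be a completely positive map on M_n(ℂ), with adjoint η*(X) = ∑_i A_iᴴ X A_i. Suppose C ∈ M_n(ℂ) is positive definite, η(C) is positive definite, and η*(η(C)⁻¹) = C⁻¹. Then Capa(η) = det(η(C)) / det(C), where Capa(η) = inf{det(η(B)) : B positive definite, det B = 1}; that is, det(η(B)) ≥ det(η(C))/det(C) for every positive definite B with det B = 1, and this value is attained. -/

import Mathlib

open Matrix
open scoped ComplexOrder

lemma Matrix.PosDef.exists_isUnit_mul_conjTranspose {n : Type*} [Fintype n] [DecidableEq n]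
    {M : Matrix n n ℂ} (hM : M.PosDef) : ∃ P : Matrix n n ℂ, IsUnit P ∧ M = P * Pᴴ := by
  open scoped MatrixOrder Matrix.Norms.L2Operator in
  obtain ⟨P, hP, rfl⟩ := CStarAlgebra.isStrictlyPositive_iff_eq_star_mul_self.mp
    hM.isStrictlyPositive
  exact ⟨Pᴴ, hP.star, by rw [conjTranspose_conjTranspose, star_eq_conjTranspose]⟩

lemma Matrix.sum_mul_mul_conjTranspose_conj {ι n : Type*} [Fintype ι] [Fintype n]
    (A : ι → Matrix n n ℂ) (L R X : Matrix n n ℂ) :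
    ∑ i, (L * A i * R) * X * (L * A i * R)ᴴ = L * (∑ i, A i * (R * X * Rᴴ) * (A i)ᴴ) * Lᴴ := by
  simp only [Finset.mul_sum, Finset.sum_mul, conjTranspose_mul, Matrix.mul_assoc]

/-- Weighted AM-GM for the image of a positive vector under a doubly stochastic matrix. -/
lemma Finset.prod_le_prod_sum_of_doublyStochastic {n : Type*} [Fintype n]
    (S : n → n → ℝ) (d : n → ℝ) (hS : ∀ k l, 0 ≤ S k l) (hrow : ∀ k, ∑ l, S k l = 1)
    (hcol : ∀ l, ∑ k, S k l = 1) (hd : ∀ l, 0 < d l) :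
    ∏ l, d l ≤ ∏ k, ∑ l, S k l * d l := by
  calc ∏ l, d l = ∏ k, ∏ l, d l ^ S k l := by
        rw [Finset.prod_comm]
        refine Finset.prod_congr rfl fun l _ => ?_
        rw [← Real.rpow_sum_of_pos (hd l), hcol, Real.rpow_one]
    _ ≤ _ := Finset.prod_le_prod
        (fun k _ => Finset.prod_nonneg fun l _ => Real.rpow_nonneg (hd l).le _)
        fun k _ => Real.geom_mean_le_arith_mean_weighted _ _ _ (fun l _ => hS k l) (hrow k)
          fun l _ => (hd l).le

lemma Matrix.mul_diagonal_mul_conjTranspose_apply_self {n : Type*} [Fintype n] [DecidableEq n]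
    (G : Matrix n n ℂ) (d : n → ℝ) (k : n) :
    (G * diagonal (fun l => (d l : ℂ)) * Gᴴ) k k
      = ((∑ l, Complex.normSq (G k l) * d l : ℝ) : ℂ) := by
  rw [Matrix.mul_apply]
  push_cast
  refine Finset.sum_congr rfl fun l _ => ?_
  rw [mul_diagonal, conjTranspose_apply, Complex.normSq_eq_conj_mul_self, Complex.star_def]
  ring

/-- A doubly stochastic completely positive map sending a positive diagonal matrix to a diagonal
matrix does not decrease the determinant. -/
lemma prod_le_prod_of_sum_diagonal {ι n : Type*} [Fintype ι] [Fintype n] [DecidableEq n]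
    (G : ι → Matrix n n ℂ) (h₁ : ∑ i, G i * (G i)ᴴ = 1) (h₂ : ∑ i, (G i)ᴴ * G i = 1)
    (d e : n → ℝ) (hd : ∀ l, 0 < d l)
    (h : ∑ i, G i * diagonal (fun l => (d l : ℂ)) * (G i)ᴴ = diagonal (fun k => (e k : ℂ))) :
    ∏ l, d l ≤ ∏ k, e k := by
  have key : ∀ (H : ι → Matrix n n ℂ) (a b : n → ℝ),
      ∑ i, H i * diagonal (fun l => (a l : ℂ)) * (H i)ᴴ = diagonal (fun k => (b k : ℂ)) →
      ∀ k, ∑ l, (∑ i, Complex.normSq (H i k l)) * a l = b k := by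
    intro H a b hab k
    have := congrFun (congrFun hab k) k
    simp only [Matrix.sum_apply, mul_diagonal_mul_conjTranspose_apply_self, diagonal_apply_eq,
      ← Complex.ofReal_sum, Complex.ofReal_inj] at this
    rw [← this, Finset.sum_comm]
    simp only [Finset.sum_mul]
  have he : e = fun k => ∑ l, (∑ i, Complex.normSq (G i k l)) * d l :=
    funext fun k => (key G d e h k).symm
  rw [he]
  refine Finset.prod_le_prod_sum_of_doublyStochastic _ d
    (fun k l => Finset.sum_nonneg fun i _ => Complex.normSq_nonneg _) (fun k => ?_) (fun l => ?_) hd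
  · simpa using key G 1 1 (by simpa using h₁) k
  · simpa using key (fun i => (G i)ᴴ) 1 1 (by simpa using h₂) l

lemma Matrix.IsHermitian.exists_unitary_diagonal {n : Type*} [Fintype n] [DecidableEq n]
    {M : Matrix n n ℂ} (hM : M.IsHermitian) : ∃ U : Matrix n n ℂ, U * Uᴴ = 1 ∧ Uᴴ * U = 1 ∧
      M = U * diagonal (fun k => (hM.eigenvalues k : ℂ)) * Uᴴ := by
  refine ⟨hM.eigenvectorUnitary, Unitary.coe_mul_star_self _, Unitary.coe_star_mul_self _, ?_⟩
  conv_lhs => rw [hM.spectral_theorem, Unitary.conjStarAlgAut_apply]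
  rfl

/-- A doubly stochastic completely positive map does not decrease the determinant of a positive
definite matrix. -/
lemma Matrix.PosDef.det_re_le_of_doublyStochastic {ι n : Type*} [Fintype ι] [Fintype n]
    [DecidableEq n] (F : ι → Matrix n n ℂ) (h₁ : ∑ i, F i * (F i)ᴴ = 1)
    (h₂ : ∑ i, (F i)ᴴ * F i = 1) {X : Matrix n n ℂ} (hX : X.PosDef) :
    X.det.re ≤ (∑ i, F i * X * (F i)ᴴ).det.re := by
  have hY : (∑ i, F i * X * (F i)ᴴ).IsHermitian :=
    (posSemidef_sum _ fun i _ => hX.posSemidef.mul_mul_conjTranspose_same (F i)).isHermitian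
  obtain ⟨U, hU, hU', hXU⟩ := hX.isHermitian.exists_unitary_diagonal
  obtain ⟨V, hV, hV', hYV⟩ := hY.exists_unitary_diagonal
  have := prod_le_prod_of_sum_diagonal (fun i => Vᴴ * F i * U) ?_ ?_
    hX.isHermitian.eigenvalues hY.eigenvalues hX.eigenvalues_pos ?_
  · rw [hX.isHermitian.det_eq_prod_eigenvalues, hY.det_eq_prod_eigenvalues]
    simpa [← Complex.ofReal_prod] using this
  · have := sum_mul_mul_conjTranspose_conj F Vᴴ U 1
    simpa [hU, h₁, hV'] using this
  · have := sum_mul_mul_conjTranspose_conj (fun i => (F i)ᴴ) Uᴴ V 1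
    simpa [hV, h₂, hU', Matrix.mul_assoc] using this
  · rw [sum_mul_mul_conjTranspose_conj, ← hXU]
    conv_lhs => rw [hYV]
    rw [conjTranspose_conjTranspose]
    calc _ = (Vᴴ * V) * diagonal (fun k => (hY.eigenvalues k : ℂ)) * (Vᴴ * V) := by
          simp only [Matrix.mul_assoc]
      _ = _ := by rw [hV', Matrix.one_mul, Matrix.mul_one]

lemma Matrix.det_re_mul_mul_conjTranspose {n : Type*} [Fintype n] [DecidableEq n]
    (L M : Matrix n n ℂ) : (L * M * Lᴴ).det.re = (L * Lᴴ).det.re * M.det.re := by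
  rw [det_mul, det_mul, det_mul, det_conjTranspose, Complex.star_def, mul_right_comm,
    Complex.mul_conj, Complex.re_ofReal_mul, Complex.ofReal_re]

/-- The determinant bound for a completely positive map at a critical point of its capacity. -/
lemma Matrix.PosDef.det_mul_det_le_of_critical {ι n : Type*} [Fintype ι] [Fintype n]
    [DecidableEq n] (A : ι → Matrix n n ℂ) {C : Matrix n n ℂ} (hC : C.PosDef)
    (hetaC : (∑ j, A j * C * (A j)ᴴ).PosDef)
    (hfoc : ∑ j, (A j)ᴴ * (∑ i, A i * C * (A i)ᴴ)⁻¹ * A j = C⁻¹)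
    {B : Matrix n n ℂ} (hB : B.PosDef) :
    (∑ j, A j * C * (A j)ᴴ).det.re * B.det.re ≤ (∑ j, A j * B * (A j)ᴴ).det.re * C.det.re := by
  obtain ⟨P, hP, hCP⟩ := hC.exists_isUnit_mul_conjTranspose
  obtain ⟨Q, hQ, hEQ⟩ := hetaC.exists_isUnit_mul_conjTranspose
  have hdP : IsUnit P.det := (isUnit_iff_isUnit_det P).mp hP
  have hdQ : IsUnit Q.det := (isUnit_iff_isUnit_det Q).mp hQ
  have hdP' : IsUnit Pᴴ.det := by rw [det_conjTranspose]; exact hdP.star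
  have hdQ' : IsUnit Qᴴ.det := by rw [det_conjTranspose]; exact hdQ.star
  have hBX : B = P * (P⁻¹ * B * (P⁻¹)ᴴ) * Pᴴ := by
    rw [conjTranspose_nonsing_inv, Matrix.mul_assoc P⁻¹, mul_nonsing_inv_cancel_left _ _ hdP,
      nonsing_inv_mul_cancel_right _ _ hdP']
  have hX : (P⁻¹ * B * (P⁻¹)ᴴ).PosDef :=
    hB.mul_mul_conjTranspose_same (vecMul_injective_iff_isUnit.mpr (isUnit_nonsing_inv_iff.mpr hP))
  have hEB : ∑ j, A j * B * (A j)ᴴ = Q * (∑ i, (Q⁻¹ * A i * P) * (P⁻¹ * B * (P⁻¹)ᴴ) *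
      (Q⁻¹ * A i * P)ᴴ) * Qᴴ := by
    rw [sum_mul_mul_conjTranspose_conj, ← hBX, conjTranspose_nonsing_inv, Matrix.mul_assoc Q⁻¹,
      mul_nonsing_inv_cancel_left _ _ hdQ, nonsing_inv_mul_cancel_right _ _ hdQ']
  have hle := hX.det_re_le_of_doublyStochastic (fun i => Q⁻¹ * A i * P) ?_ ?_
  · have hQ0 : 0 ≤ (Q * Qᴴ).det.re := hEQ ▸ (Complex.pos_iff.mp hetaC.det_pos).1.le
    have hP0 : 0 ≤ (P * Pᴴ).det.re := hCP ▸ (Complex.pos_iff.mp hC.det_pos).1.le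
    have hBdet := det_re_mul_mul_conjTranspose P (P⁻¹ * B * (P⁻¹)ᴴ)
    rw [← hBX] at hBdet
    rw [hEB, hEQ, hBdet, det_re_mul_mul_conjTranspose Q, hCP]
    linarith [mul_le_mul_of_nonneg_left hle (mul_nonneg hQ0 hP0)]
  · have := sum_mul_mul_conjTranspose_conj A Q⁻¹ P 1
    rw [Matrix.mul_one, ← hCP, hEQ, conjTranspose_nonsing_inv,
      nonsing_inv_mul_cancel_left _ _ hdQ, mul_nonsing_inv _ hdQ'] at this
    simpa using this
  · have hinv : (Q * Qᴴ)⁻¹ = (Q⁻¹)ᴴ * Q⁻¹ := by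
      rw [mul_inv_rev, conjTranspose_nonsing_inv]
    calc ∑ i, (Q⁻¹ * A i * P)ᴴ * (Q⁻¹ * A i * P)
        = Pᴴ * (∑ i, (A i)ᴴ * (Q * Qᴴ)⁻¹ * A i) * P := by
          simp only [hinv, Finset.mul_sum, Finset.sum_mul, conjTranspose_mul, Matrix.mul_assoc]
      _ = Pᴴ * (Pᴴ⁻¹ * P⁻¹) * P := by rw [← hEQ, hfoc, hCP, mul_inv_rev]
      _ = 1 := by
          rw [mul_nonsing_inv_cancel_left _ _ hdP', nonsing_inv_mul _ hdP]

/-- A positive definite matrix can be rescaled to determinant one. -/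
lemma Matrix.PosDef.exists_pow_mul_det_eq_one {n : Type*} [Fintype n] [DecidableEq n]
    {C : Matrix n n ℂ} (hC : C.PosDef) :
    ∃ c : ℝ, 0 < c ∧ c ^ Fintype.card n * C.det.re = 1 := by
  have hpos : 0 < C.det.re := (Complex.pos_iff.mp hC.det_pos).1
  rcases isEmpty_or_nonempty n with _ | _
  · exact ⟨1, one_pos, by simp⟩
  · refine ⟨(C.det.re⁻¹) ^ ((Fintype.card n : ℝ)⁻¹), Real.rpow_pos_of_pos (inv_pos.mpr hpos) _, ?_⟩
    rw [Real.rpow_inv_natCast_pow (inv_pos.mpr hpos).le Fintype.card_ne_zero,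
      inv_mul_cancel₀ hpos.ne']

/-- **critical points are capacity minimizers.** Let
`η(X) = ∑ᵢ Aᵢ X Aᵢᴴ` with adjoint `η*(X) = ∑ᵢ Aᵢᴴ X Aᵢ`, let `C ≻ 0` with `η(C) ≻ 0` and
`η*(η(C)⁻¹) = C⁻¹`.  Then `Capa(η) = det(η(C))/det(C)`: every positive definite `B` with
`det B = 1` satisfies `det(η(B)) ≥ det(η(C))/det(C)`, and this value is attained. -/
theorem critical_point_capacity {n r : ℕ}
    (A : Fin r → Matrix (Fin n) (Fin n) ℂ)
    (C : Matrix (Fin n) (Fin n) ℂ) (hC : C.PosDef)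
    (hetaC : (∑ j, A j * C * (A j)ᴴ).PosDef)
    (hfoc : ∑ j, (A j)ᴴ * (∑ i, A i * C * (A i)ᴴ)⁻¹ * A j = C⁻¹) :
    (∀ B : Matrix (Fin n) (Fin n) ℂ, B.PosDef → B.det = 1 →
      (∑ j, A j * C * (A j)ᴴ).det.re / C.det.re ≤ (∑ j, A j * B * (A j)ᴴ).det.re) ∧
    (∃ B : Matrix (Fin n) (Fin n) ℂ, B.PosDef ∧ B.det = 1 ∧
      (∑ j, A j * B * (A j)ᴴ).det.re = (∑ j, A j * C * (A j)ᴴ).det.re / C.det.re) := by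
  have hpos : 0 < C.det.re := (Complex.pos_iff.mp hC.det_pos).1
  refine ⟨fun B hB hdet => ?_, ?_⟩
  · rw [div_le_iff₀ hpos]
    simpa [hdet] using hC.det_mul_det_le_of_critical A hetaC hfoc hB
  · obtain ⟨c, hc, hdet⟩ := hC.exists_pow_mul_det_eq_one
    rw [Fintype.card_fin] at hdet
    have hCre : C.det = (C.det.re : ℂ) :=
      Complex.ext rfl (by simpa using (Complex.pos_iff.mp hC.det_pos).2.symm)
    have hsum : ∑ j, A j * ((c : ℂ) • C) * (A j)ᴴ = (c : ℂ) • ∑ j, A j * C * (A j)ᴴ := by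
      simp only [Matrix.mul_smul, Matrix.smul_mul, Finset.smul_sum]
    refine ⟨(c : ℂ) • C, hC.smul (Complex.zero_lt_real.mpr hc), ?_, ?_⟩
    · rw [det_smul, Fintype.card_fin, hCre]
      exact_mod_cast hdet
    · rw [hsum, det_smul, Fintype.card_fin, ← Complex.ofReal_pow, Complex.re_ofReal_mul,
        eq_div_iff hpos.ne', mul_right_comm, hdet, one_mul]
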